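/- Let D be a positive integer. Then there do not exist four distinct integers n₁, n₂, n₃, n₄ in geometric progression (i.e. there is a nonzero rational r with n₂ = n₁ r, n₃ = n₁ r², n₄ = n₁ r³) such that each nᵢ is of the form D m² + δ for some positive integer m and some δ ∈ {4, −4}. -/

import Mathlib

/-- Residue test for being a square (necessary condition). -/
def isSq (x : ℕ) : Bool :=
  (Nat.testBit 144680414395695635 (x % 64) &&
  (Nat.testBit 288872697407275667 (x % 63) &&
  (Nat.testBit 20863489977805260307 (x % 65) &&
  (Nat.testBit 571 (x % 11) &&
  (Nat.testBit 107287 (x % 17) &&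
  (Nat.testBit 199411 (x % 19) &&
  (Nat.testBit 340831 (x % 23) &&
  (Nat.testBit 332473075 (x % 29) &&
  Nat.testBit 303908791 (x % 31)))))))))

theorem testBit_sq (p q : ℕ) (hq : 0 < q) (h : ∀ r < q, Nat.testBit p (r * r % q) = true) (y : ℕ) :
    Nat.testBit p (y * y % q) = true := by
  rw [Nat.mul_mod]; exact h _ (Nat.mod_lt _ hq)

theorem isSq_of_sq (x y : ℕ) (h : x = y * y) : isSq x = true := by
  subst h
  simp only [isSq, Bool.and_eq_true]
  refine ⟨?_, ?_, ?_, ?_, ?_, ?_, ?_, ?_, ?_⟩ <;>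
    exact testBit_sq _ _ (by norm_num) (by decide) y

/-- `n - 4 e` where `true` encodes `e = 1`. -/
def shift (n : ℕ) : Bool → ℕ
  | true => n - 4
  | false => n + 4

/-- Both values of a sign. -/
def both (p : Bool → Bool) : Bool := p true && p false

theorem both_spec (p : Bool → Bool) (h : both p = true) (e : Bool) : p e = true := by
  simp only [both, Bool.and_eq_true] at h
  cases e
  · exact h.2
  · exact h.1

/-- No sign pattern works. -/
def bad (k a b : ℕ) : Bool :=
  both fun e1 => !(Nat.blt 0 (shift (k * a ^ 3) e1)) || both fun e3 =>
    !(isSq (shift (k * a ^ 3) e1 * shift (k * a * b ^ 2) e3)) || both fun e2 =>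
    !(isSq (shift (k * a ^ 3) e1 * shift (k * a ^ 2 * b) e2)) || both fun e4 =>
    !(isSq (shift (k * a ^ 3) e1 * shift (k * b ^ 3) e4))

/-- Bounded quantifier. -/
def allBelow : ℕ → (ℕ → Bool) → Bool
  | 0, _ => true
  | n + 1, p => p n && allBelow n p

theorem allBelow_spec (p : ℕ → Bool) (n : ℕ) (h : allBelow n p = true) :
    ∀ i < n, p i = true := by
  induction n with
  | zero => intro i hi; omega
  | succ n ih =>
    simp only [allBelow, Bool.and_eq_true] at h
    intro i hi
    rcases Nat.lt_succ_iff_lt_or_eq.mp hi with h' | h'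
    · exact ih h.2 i h'
    · rw [h']; exact h.1

theorem region1 : allBelow 34 (fun a => allBelow ((11 + 33 * a) / (a * a) + 1) (fun k =>
    allBelow (3 * a * a) (fun b =>
      !(Nat.blt a b && (Nat.ble (k * a ^ 3) (11 * (a + b)) && (Nat.ble 1 k && Nat.ble 1 a))) ||
      bad k a b))) = true := by
  decide +kernel

theorem region2 : allBelow 4 (fun a => allBelow 16 (fun k =>
    allBelow (12 * a * a) (fun b =>
      !(Nat.blt a b && (Nat.ble (k * a ^ 2) 15 && (Nat.ble 1 k && Nat.ble 1 a))) ||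
      bad k a b))) = true := by
  decide +kernel

theorem region3 : allBelow 9 (fun a => allBelow 21 (fun k =>
    allBelow 30 (fun b =>
      !(Nat.blt a b && (Nat.ble 1 k && Nat.ble 1 a)) ||
      bad k a b))) = true := by
  decide +kernel

theorem blt_of {a b : ℕ} (h : a < b) : Nat.blt a b = true := by
  rw [Nat.blt_eq]; exact h

theorem fin1 (k a b : ℕ) (hk : 1 ≤ k) (ha : 1 ≤ a) (hab : a < b) (hb : b < 3 * a * a)
    (h1 : k * a ^ 3 ≤ 11 * (a + b)) (h2 : k * (a * a) ≤ 11 + 33 * a) : bad k a b = true := by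
  have ha' : a < 34 := by
    by_contra hc
    push Not at hc
    nlinarith [Nat.mul_le_mul hk (le_refl (a * a))]
  have hk' : k < (11 + 33 * a) / (a * a) + 1 :=
    Nat.lt_succ_of_le ((Nat.le_div_iff_mul_le (by positivity)).mpr h2)
  have := allBelow_spec _ _ (allBelow_spec _ _ (allBelow_spec _ _ region1 a ha') k hk') b hb
  simpa [blt_of hab, Nat.ble_eq_true_of_le hk, Nat.ble_eq_true_of_le ha,
    Nat.ble_eq_true_of_le h1] using this

theorem fin2 (k a b : ℕ) (hk : 1 ≤ k) (ha : 1 ≤ a) (hab : a < b) (hb : b < 12 * a * a)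
    (h1 : k * a ^ 2 ≤ 15) : bad k a b = true := by
  have ha' : a < 4 := by
    by_contra hc
    push Not at hc
    nlinarith [Nat.mul_le_mul hk (le_refl (a * a))]
  have hk' : k < 16 := by nlinarith
  have := allBelow_spec _ _ (allBelow_spec _ _ (allBelow_spec _ _ region2 a ha') k hk') b hb
  simpa [blt_of hab, Nat.ble_eq_true_of_le hk, Nat.ble_eq_true_of_le ha,
    Nat.ble_eq_true_of_le h1] using this

theorem fin3 (k a b : ℕ) (hk : 1 ≤ k) (ha : 1 ≤ a) (hab : a < b) (hb : b < 30)
    (hk' : k < 21) (ha' : a < 9) : bad k a b = true := by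
  have := allBelow_spec _ _ (allBelow_spec _ _ (allBelow_spec _ _ region3 a ha') k hk') b hb
  simpa [blt_of hab, Nat.ble_eq_true_of_le hk, Nat.ble_eq_true_of_le ha] using this

theorem bad_false (k a b D m1 m2 m3 m4 : ℕ) (e1 e2 e3 e4 : Bool) (h : bad k a b = true)
    (hp : 0 < D * m1 ^ 2)
    (h1 : shift (k * a ^ 3) e1 = D * m1 ^ 2) (h2 : shift (k * a ^ 2 * b) e2 = D * m2 ^ 2)
    (h3 : shift (k * a * b ^ 2) e3 = D * m3 ^ 2) (h4 : shift (k * b ^ 3) e4 = D * m4 ^ 2) :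
    False := by
  have q := both_spec _ h e1
  rw [h1] at q
  have q2 : (both fun e3 =>
    !(isSq (D * m1 ^ 2 * shift (k * a * b ^ 2) e3)) || both fun e2 =>
    !(isSq (D * m1 ^ 2 * shift (k * a ^ 2 * b) e2)) || both fun e4 =>
    !(isSq (D * m1 ^ 2 * shift (k * b ^ 3) e4))) = true := by
    have hb : Nat.blt 0 (D * m1 ^ 2) = true := by rw [Nat.blt_eq]; exact hp
    rw [hb] at q
    simpa using q
  have q3 := both_spec _ q2 e3
  rw [h3, isSq_of_sq _ (D * m1 * m3) (by ring)] at q3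
  have q4 := both_spec _ (by simpa using q3) e2
  rw [h2, isSq_of_sq _ (D * m1 * m2) (by ring)] at q4
  have q5 := both_spec _ (by simpa using q4) e4
  rw [h4, isSq_of_sq _ (D * m1 * m4) (by ring)] at q5
  simp at q5

/-- Exact relations for a pair of terms with ratio `b² / a²`. -/
theorem pair_lemma (a b D m M e f N : ℤ) (ha : 0 < a) (hab : a < b) (hD : 0 < D) (hm : 0 < m)
    (hM : 0 < M) (he : e = 1 ∨ e = -1) (hf : f = 1 ∨ f = -1) (hN : N = D * m ^ 2 + 4 * e)
    (hp : b ^ 2 * N = a ^ 2 * (D * M ^ 2 + 4 * f)) :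
    ∃ s i : ℤ, 0 < s ∧ D * s ^ 2 + 4 * f * a ^ 2 = 2 * b * i ∧
      (2 * b - e * i) ^ 2 = (N - 4 * e) * (D * s ^ 2) ∧
      a ∣ D * s ^ 2 + 4 * e * b ^ 2 ∧
      b * i < 2 * b ^ 2 + 4 * a ^ 2 ∧
      (16 ≤ N → D * s ^ 2 * N ≤ 22 * b ^ 2) := by
  have he2 : e * e = 1 := by rcases he with rfl | rfl <;> norm_num
  have hb : 0 < b := by linarith
  have hbm : 0 < b * m := by positivity
  have haM : 0 < a * M := by positivity
  have hb2 : a ^ 2 < b ^ 2 := by nlinarith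
  have key : D * (a * M - b * m) * (a * M + b * m) = 4 * (e * b ^ 2 - f * a ^ 2) := by
    subst hN; linear_combination -hp
  obtain ⟨s, hs⟩ : ∃ s, s = e * (a * M - b * m) := ⟨_, rfl⟩
  have hs0 : 0 < s := by
    have h1 : 0 < s * (D * (a * M + b * m)) := by
      have : s * (D * (a * M + b * m)) = 4 * (b ^ 2 - e * f * a ^ 2) := by
        rw [hs]; linear_combination e * key + 4 * b ^ 2 * he2
      rw [this]
      rcases he with rfl | rfl <;> rcases hf with rfl | rfl <;> nlinarith
    exact pos_of_mul_pos_left h1 (by positivity)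
  have haMs : a * M = b * m + e * s := by rw [hs]; linear_combination (-(a * M - b * m)) * he2
  have key2 : D * s * (2 * b * m + e * s) = 4 * (b ^ 2 - e * f * a ^ 2) := by
    rw [haMs] at key
    linear_combination e * key + (4 * b ^ 2 - D * s * (2 * b * m + e * s)) * he2
  have hDs : 0 < D * s := by positivity
  have hf1 : e * f ≤ 1 ∧ -1 ≤ e * f := by
    rcases he with rfl | rfl <;> rcases hf with rfl | rfl <;> norm_num
  have hr : 4 * (b ^ 2 - e * f * a ^ 2) ≤ 4 * b ^ 2 + 4 * a ^ 2 := by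
    nlinarith [sq_nonneg a]
  have hDsm : b * (D * s * m) < 4 * b ^ 2 + 4 * a ^ 2 := by
    have : b * m < 2 * b * m + e * s := by nlinarith
    nlinarith [mul_lt_mul_of_pos_left this hDs]
  refine ⟨s, e * (2 * b - D * m * s), hs0, ?_, ?_, ?_, ?_, ?_⟩
  · linear_combination e * key2 + (-4*f*a^2 - D * s ^ 2) * he2
  · subst hN
    have h : e * (e * (2 * b - D * m * s)) = 2 * b - D * m * s := by
      linear_combination (2 * b - D * m * s) * he2
    rw [h]; ring
  · refine ⟨2 * (e * (D * s * M)) + 4 * f * a, ?_⟩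
    linear_combination -2 * e * D * s * haMs - e * key2 + (4 * f * a ^ 2 - D * s ^ 2) * he2
  · rcases he with rfl | rfl
    · have : 0 < b * (D * m * s) := by positivity
      nlinarith [sq_nonneg a]
    · nlinarith
  · intro hN16
    have hy2 : (D * m * s) ^ 2 = (D * m ^ 2) * (D * s ^ 2) := by ring
    have hq : 0 < D * s ^ 2 := by positivity
    have hyp : 0 < D * m * s := by positivity
    have hq2 : 2 * b * (D * m * s) + e * (D * s ^ 2) < 8 * b ^ 2 := by nlinarith
    have hsb' : e = -1 → s < b * m := by intro h; rw [h] at haMs; linarith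
    obtain ⟨P, hP⟩ : ∃ P, P = D * m ^ 2 := ⟨_, rfl⟩
    obtain ⟨y, hy⟩ : ∃ y, y = D * m * s := ⟨_, rfl⟩
    obtain ⟨q, hqq⟩ : ∃ q, q = D * s ^ 2 := ⟨_, rfl⟩
    have hyP' : e = -1 → y < P * b := by
      intro h
      rw [hy, hP]
      have : 0 < D * m := by positivity
      linarith [mul_lt_mul_of_pos_left (hsb' h) this]
    rw [← hP] at hN hy2
    rw [← hy] at hy2 hq2 hyp
    rw [← hqq] at hy2 hq2 hq ⊢
    clear key key2 haMs hs hDsm hr hf1 hp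
    have hqN : 0 ≤ q * (N - 16) := mul_nonneg hq.le (by linarith)
    rcases he with rfl | rfl
    · have hy4 : y < 4 * b := by
        have : 2 * b * y < 2 * b * (4 * b) := by linarith
        exact lt_of_mul_lt_mul_left this (by linarith)
      have : y ^ 2 ≤ (4 * b) ^ 2 := pow_le_pow_left₀ hyp.le hy4.le 2
      have hPN : P = N - 4 := by linarith
      rw [hPN] at hy2
      linarith
    · have hyP := hyP' rfl
      have hP20 : 20 ≤ P := by linarith
      have hmain : 2 * b * y * P - y ^ 2 < 8 * b ^ 2 * P := by
        have := mul_lt_mul_of_pos_right hq2 (show 0 < P by linarith)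
        linarith
      have hbb : 0 < b * b := by positivity
      have h46 : 5 * y ≤ 23 * b := by
        by_contra hc
        push Not at hc
        have h1 : 0 < (5 * y - 23 * b) * (10 * b * P - 5 * y - 23 * b) := by
          apply mul_pos
          · linarith
          · nlinarith
        have h2 : 0 ≤ (b * b) * (P - 20) := mul_nonneg hbb.le (by linarith)
        linarith
      have : (5 * y) ^ 2 ≤ (23 * b) ^ 2 := pow_le_pow_left₀ (by linarith) h46 2
      have hPN : P = N + 4 := by linarith
      rw [hPN] at hy2
      linarith

/-- `b` is bounded by a multiple of `a²`. -/
theorem upper_bound (k a b j e f q : ℤ) (hk : 0 < k) (ha : 0 < a) (hab : a < b)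
    (hc : IsCoprime a b) (he : e = 1 ∨ e = -1) (hf : f = 1 ∨ f = -1) (hq : 0 < q)
    (h1 : q + 4 * f * a ^ 2 = 2 * b * j)
    (h2 : (2 * b - e * j) ^ 2 = (k * a ^ 2 * b - 4 * e) * q)
    (h3 : b * j < 2 * b ^ 2 + 4 * a ^ 2) :
    b < 12 * a ^ 2 ∧ (16 ≤ k * a ^ 2 → b < 3 * a ^ 2) := by
  have hb : 0 < b := by linarith
  have ha2 : 1 ≤ a ^ 2 := by nlinarith
  obtain ⟨A, hA⟩ : ∃ A, A = k * a ^ 2 := ⟨_, rfl⟩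
  obtain ⟨c, hcc⟩ : ∃ c, c = a ^ 2 := ⟨_, rfl⟩
  have hq' : q = 2 * b * j - 4 * f * c := by rw [hcc]; linarith
  have hA1 : 1 ≤ A := by rw [hA]; nlinarith
  have eqn : 4 * b ^ 2 + 4 * e * b * j + j ^ 2 =
      A * (2 * b ^ 2 * j - 4 * f * c * b) + 16 * e * f * c := by
    rw [← hA, hq'] at h2
    have he2 : e * e = 1 := by rcases he with rfl | rfl <;> norm_num
    linear_combination h2 - j ^ 2 * he2
  have hdiv : j = 0 → b ∣ 4 := by
    intro hj
    subst hj
    have : b ∣ 4 * a ^ 2 := by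
      rw [← hcc]
      have hx : 16 * e * f * c = b * (4 * b + A * 4 * f * c) := by linear_combination -eqn
      have hy : 4 * c = b * (e * f * (b + A * f * c)) := by
        rcases he with rfl | rfl <;> rcases hf with rfl | rfl <;> linarith
      exact ⟨_, hy⟩
    have hc2 : IsCoprime b (a ^ 2) := (hc.symm).pow_right
    exact hc2.dvd_of_dvd_mul_right this
  rw [← hcc] at ha2 h3
  rw [← hA, ← hcc]
  have hjge : 3 * c ≤ b → 0 ≤ j := by
    intro h
    by_contra hj
    push Not at hj
    have : b * j ≤ -b := by nlinarith
    rcases hf with rfl | rfl <;> nlinarith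
  have hjle : 3 * c ≤ b → j ≤ 2 * b + 1 := by
    intro h
    by_contra hj
    push Not at hj
    have : b * (2 * b + 2) ≤ b * j := by nlinarith
    nlinarith
  have hj0 : 3 * c ≤ b → j = 0 → b ≤ 4 := fun _ hj => Int.le_of_dvd (by norm_num) (hdiv hj)
  have hL : ∀ j', j' = j → 3 * c ≤ b → 4 * b ^ 2 + 4 * e * b * j + j ^ 2 ≤ 4 * b ^ 2 + 6 * b * j + j := by
    intro _ _ h
    have := hjge h
    have := hjle h
    have : 0 ≤ b * j := by positivity
    rcases he with rfl | rfl <;> nlinarith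
  have hcb : 0 < c * b := by positivity
  have hcA : c ≤ A := by rw [hA, ← hcc]; exact le_mul_of_one_le_left (by linarith) hk
  constructor
  · by_contra hlt
    push Not at hlt
    have h3c : 3 * c ≤ b := by linarith
    have hj := hjge h3c
    have hL := hL j rfl h3c
    have hjne : j ≠ 0 := fun h => by have := hj0 h3c h; linarith
    have hj1 : 1 ≤ j := by omega
    have hj2 := hjle h3c
    have hef : -(16 * c) ≤ 16 * e * f * c := by
      rcases he with rfl | rfl <;> rcases hf with rfl | rfl <;> linarith
    have hfc : 4 * f * c * b ≤ 4 * c * b := by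
      rcases hf with rfl | rfl <;> linarith
    have hb12 : 12 ≤ b := by linarith
    have hcb2 : 12 * (c * b) ≤ b ^ 2 := by
      have := mul_le_mul_of_nonneg_right hlt hb.le
      linarith
    have hbb : 12 * b ≤ b ^ 2 := by
      have := mul_le_mul_of_nonneg_right hb12 hb.le
      linarith
    have hbj : b ^ 2 ≤ b ^ 2 * j := le_mul_of_one_le_right (sq_nonneg b) hj1
    have hbj1 : 12 * j ≤ b * j := mul_le_mul_of_nonneg_right hb12 hj
    have hbj2 : 12 * (b * j) ≤ b ^ 2 * j := by
      have := mul_le_mul_of_nonneg_right hbb hj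
      linarith
    clear hjge hjle hj0 hdiv h1 h2 h3 hq hq' hc hj2 hA
    rcases (show A = 1 ∨ A = 2 ∨ 3 ≤ A by omega) with h | h | h
    · subst h
      rw [one_mul] at eqn
      have hc1 : c = 1 := by omega
      subst hc1
      rcases (show j = 1 ∨ j = 2 ∨ 3 ≤ j by omega) with h | h | h
      · subst h
        rcases he with rfl | rfl <;> rcases hf with rfl | rfl <;> linarith
      · subst h
        rcases he with rfl | rfl <;> rcases hf with rfl | rfl <;> linarith
      · have : b ^ 2 * 3 ≤ b ^ 2 * j := mul_le_mul_of_nonneg_left h (sq_nonneg b)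
        linarith
    · subst h
      rcases (show j = 1 ∨ 2 ≤ j by omega) with h | h
      · subst h
        exfalso
        have : 2 * (2 * e * b + 4 * f * c * b - 8 * e * f * c) = -1 := by linear_combination eqn
        omega
      · have : b ^ 2 * 2 ≤ b ^ 2 * j := mul_le_mul_of_nonneg_left h (sq_nonneg b)
        linarith
    · have hpos : 0 ≤ 2 * b ^ 2 * j - 4 * f * c * b := by linarith
      have := mul_le_mul_of_nonneg_right h hpos
      linarith
  · intro hA16
    by_contra hlt
    push Not at hlt
    have h3c := hlt
    have hj := hjge h3c
    have hL := hL j rfl h3c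
    have hef : -(16 * c) ≤ 16 * e * f * c := by
      rcases he with rfl | rfl <;> rcases hf with rfl | rfl <;> linarith
    have hfc : 4 * f * c * b ≤ 4 * c * b := by
      rcases hf with rfl | rfl <;> linarith
    have hcb2 : 3 * (c * b) ≤ b ^ 2 := by
      have := mul_le_mul_of_nonneg_right hlt hb.le
      linarith
    have hjne : j ≠ 0 := by
      intro h
      have h4 := hj0 h3c h
      have hc1 : c = 1 := by omega
      subst h
      subst hc1
      have h5 : 16 * b ≤ A * b := mul_le_mul_of_nonneg_right hA16 hb.le
      have h6 : b * b ≤ 4 * b := mul_le_mul_of_nonneg_right h4 hb.le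
      have h7 := mul_pos (show 0 < A by linarith) hb
      rcases he with rfl | rfl <;> rcases hf with rfl | rfl <;> nlinarith only [eqn, h5, h6, h4, h3c, h7]
    have hj1 : 1 ≤ j := by omega
    have hb3 : 3 ≤ b := by linarith
    have hbb : 3 * b ≤ b ^ 2 := by
      have := mul_le_mul_of_nonneg_right hb3 hb.le
      linarith
    have hbj : b ^ 2 ≤ b ^ 2 * j := le_mul_of_one_le_right (sq_nonneg b) hj1
    have hbj1 : 3 * j ≤ b * j := mul_le_mul_of_nonneg_right hb3 hj
    have hbj2 : 3 * (b * j) ≤ b ^ 2 * j := by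
      have := mul_le_mul_of_nonneg_right hbb hj
      linarith
    have hpos : 0 ≤ 2 * b ^ 2 * j - 4 * f * c * b := by linarith
    have := mul_le_mul_of_nonneg_right hA16 hpos
    linarith

theorem shift_eq (n x : ℕ) (e : ℤ) (he : e = 1 ∨ e = -1) (h : (n : ℤ) = x + 4 * e) :
    shift n (decide (e = 1)) = x := by
  rcases he with rfl | rfl
  · simp [shift]; omega
  · simp [shift]; omega

theorem core (k a b D m1 m2 m3 m4 : ℕ) (e1 e2 e3 e4 : ℤ) (hk : 0 < k) (ha : 0 < a) (hab : a < b)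
    (hc : Nat.Coprime a b) (hD : 0 < D) (hm1 : 0 < m1) (hm2 : 0 < m2) (hm3 : 0 < m3)
    (hm4 : 0 < m4) (he1 : e1 = 1 ∨ e1 = -1) (he2 : e2 = 1 ∨ e2 = -1)
    (he3 : e3 = 1 ∨ e3 = -1) (he4 : e4 = 1 ∨ e4 = -1)
    (h1 : (k : ℤ) * a ^ 3 = D * m1 ^ 2 + 4 * e1)
    (h2 : (k : ℤ) * a ^ 2 * b = D * m2 ^ 2 + 4 * e2)
    (h3 : (k : ℤ) * a * b ^ 2 = D * m3 ^ 2 + 4 * e3)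
    (h4 : (k : ℤ) * b ^ 3 = D * m4 ^ 2 + 4 * e4) : False := by
  have fin : bad k a b = true → False := by
    intro hb
    refine bad_false k a b D m1 m2 m3 m4 _ _ _ _ hb (by positivity)
      (shift_eq _ _ e1 he1 ?_) (shift_eq _ _ e2 he2 ?_) (shift_eq _ _ e3 he3 ?_)
      (shift_eq _ _ e4 he4 ?_)
    all_goals push_cast; assumption
  have hcz : IsCoprime (a : ℤ) (b : ℤ) := Nat.isCoprime_iff_coprime.mpr hc
  have hkz : (0 : ℤ) < k := by exact_mod_cast hk
  have haz : (0 : ℤ) < a := by exact_mod_cast ha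
  have habz : (a : ℤ) < b := by exact_mod_cast hab
  have hDz : (0 : ℤ) < D := by exact_mod_cast hD
  obtain ⟨s, i, hs, p1, p2, p3, p4, p5⟩ := pair_lemma a b D m1 m3 e1 e3 (k * a ^ 3) haz habz hDz
    (by exact_mod_cast hm1) (by exact_mod_cast hm3) he1 he3 h1
    (by rw [← h3]; ring)
  obtain ⟨t, j, ht, q1, q2, q3, q4, q5⟩ := pair_lemma a b D m2 m4 e2 e4 (k * a ^ 2 * b) haz habz hDz
    (by exact_mod_cast hm2) (by exact_mod_cast hm4) he2 he4 h2
    (by rw [← h4]; ring)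
  have hq : 0 < (D : ℤ) * t ^ 2 := by positivity
  have hp : 0 < (D : ℤ) * s ^ 2 := by positivity
  obtain ⟨u1, u2⟩ := upper_bound k a b j e2 e4 (D * t ^ 2) hkz haz habz hcz he2 he4 hq q1 q2 q4
  clear h1 h2 h3 h4
  generalize (D : ℤ) * t ^ 2 = q at *
  generalize (D : ℤ) * s ^ 2 = p at *
  clear p4 q4
  by_cases hsmall : k * a ^ 2 ≤ 15
  · refine fin (fin2 k a b hk ha hab ?_ hsmall)
    zify; linarith
  have hA : (16 : ℤ) ≤ k * a ^ 2 := by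
    have : 16 ≤ k * a ^ 2 := by omega
    exact_mod_cast this
  have u3 := u2 hA
  have hbz : (0 : ℤ) < b := by linarith
  have ha1 : (1 : ℤ) ≤ a := haz
  by_cases hcase : e3 = e4 ∧ i = j
  · obtain ⟨rfl, rfl⟩ := hcase
    have hpq : p = q := by linarith
    subst hpq
    have ha2 : (1 : ℤ) ≤ (a : ℤ) ^ 2 := by nlinarith only [ha1]
    have hee : e2 = -e1 := by
      rcases he1 with rfl | rfl <;> rcases he2 with rfl | rfl <;> try norm_num
      all_goals
        exfalso
        have h : ((k : ℤ) * a ^ 2 * (b - a)) * p = 0 := by linear_combination p2 - q2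
        have : 0 < ((k : ℤ) * a ^ 2 * (b - a)) * p := by
          have : (0 : ℤ) < b - a := by linarith
          positivity
        linarith
    subst hee
    have he11 : e1 * e1 = 1 := by rcases he1 with rfl | rfl <;> norm_num
    have key : ((k : ℤ) * a ^ 2 * (b - a) + 4 * e1) * p = 16 * e1 * e3 * a ^ 2 := by
      linear_combination p2 - q2 - 4 * e1 * p1
    have ha8 : (a : ℤ) ∣ 8 := by
      have h : (a : ℤ) ∣ 8 * (b : ℤ) ^ 2 := by
        have := dvd_sub p3 q3
        have h' : p + 4 * e1 * (b : ℤ) ^ 2 - (p + 4 * -e1 * (b : ℤ) ^ 2) = e1 * (8 * b ^ 2) := by ring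
        rw [h'] at this
        rcases he1 with rfl | rfl
        · simpa using this
        · simpa using this
      exact (hcz.pow_right).dvd_of_dvd_mul_right h
    have ha9 : (a : ℤ) ≤ 8 := Int.le_of_dvd (by norm_num) ha8
    have hbound : (k : ℤ) * (b - a) ≤ 20 := by
      by_contra hcon
      push Not at hcon
      have h21 : 21 * (a : ℤ) ^ 2 ≤ (k : ℤ) * (b - a) * a ^ 2 :=
        mul_le_mul_of_nonneg_right hcon (by linarith)
      have hX : 17 * (a : ℤ) ^ 2 ≤ (k : ℤ) * a ^ 2 * (b - a) + 4 * e1 := by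
        rcases he1 with rfl | rfl <;> linarith
      have hR : 16 * e1 * e3 * (a : ℤ) ^ 2 ≤ 16 * a ^ 2 := by
        rcases he1 with rfl | rfl <;> rcases he3 with rfl | rfl <;> linarith
      have hX0 : 0 ≤ (k : ℤ) * a ^ 2 * (b - a) + 4 * e1 := by linarith
      have := le_mul_of_one_le_right hX0 (show 1 ≤ p from hp)
      linarith
    have hk1 : (1 : ℤ) ≤ k := hkz
    have hba : (1 : ℤ) ≤ b - a := by linarith
    have hk20 : (k : ℤ) ≤ 20 := le_trans (le_mul_of_one_le_right hkz.le hba) hbound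
    have hb20 : (b : ℤ) - a ≤ 20 := le_trans (le_mul_of_one_le_left (by linarith) hk1) hbound
    exact fin (fin3 k a b hk ha hab (by omega) (by omega) (by omega))
  · have hsum : 2 * (b : ℤ) ≤ p + q := by
      by_cases h34 : e3 = e4
      · subst h34
        have hij : i ≠ j := fun h => hcase ⟨rfl, h⟩
        rcases lt_or_gt_of_ne hij with h | h
        · have : (b : ℤ) * 1 ≤ b * (j - i) := mul_le_mul_of_nonneg_left (by omega) hbz.le
          linarith
        · have : (b : ℤ) * 1 ≤ b * (i - j) := mul_le_mul_of_nonneg_left (by omega) hbz.le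
          linarith
      · have hz : e3 + e4 = 0 := by
          rcases he3 with rfl | rfl <;> rcases he4 with rfl | rfl <;> simp_all
        have hpq : p + q = 2 * b * (i + j) := by
          linear_combination p1 + q1 - 4 * (a : ℤ) ^ 2 * hz
        have hij : 0 < i + j := by
          have h : 0 < 2 * (b : ℤ) * (i + j) := by rw [← hpq]; linarith
          exact pos_of_mul_pos_right h (by linarith)
        have : (b : ℤ) * 1 ≤ b * (i + j) := mul_le_mul_of_nonneg_left hij hbz.le
        linarith
    have hA3 : (16 : ℤ) ≤ k * a ^ 3 := by nlinarith only [hA, ha1]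
    have hA2b : (16 : ℤ) ≤ k * a ^ 2 * b := by nlinarith only [hA, habz, ha1]
    have r1 := p5 hA3
    have r2 := q5 hA2b
    -- multiply `hsum` by `k a³ b`
    have r3 : q * ((k : ℤ) * a ^ 3) ≤ 22 * a * b := by
      have h : (b : ℤ) * (q * (k * a ^ 3)) ≤ b * (22 * a * b) := by
        have := mul_le_mul_of_nonneg_left r2 haz.le
        linarith
      exact le_of_mul_le_mul_left h hbz
    have r4 : (k : ℤ) * a ^ 3 ≤ 11 * (a + b) := by
      have h0 := mul_le_mul_of_nonneg_right hsum (show (0 : ℤ) ≤ k * a ^ 3 by linarith)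
      have h : (2 * b : ℤ) * (k * a ^ 3) ≤ (2 * b) * (11 * (a + b)) := by linarith
      exact le_of_mul_le_mul_left h (by linarith)
    have r5 : (k : ℤ) * (a * a) ≤ 11 + 33 * a := by
      have h : (a : ℤ) * (k * (a * a)) ≤ a * (11 + 33 * a) := by linarith
      exact le_of_mul_le_mul_left h haz
    refine fin (fin1 k a b hk ha hab ?_ ?_ ?_)
    · zify; linarith
    · zify; linarith
    · zify; linarith

theorem neg_val (D m : ℕ) (n d : ℤ) (hD : 0 < D) (hm : 0 < m) (hd : d = 4 ∨ d = -4)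
    (h : n = (D : ℤ) * (m : ℤ) ^ 2 + d) (hn : n < 0) : n = D - 4 := by
  have hDz : (1 : ℤ) ≤ D := by exact_mod_cast hD
  have hmz : (1 : ℤ) ≤ m := by exact_mod_cast hm
  have hd' : d = -4 := by
    rcases hd with rfl | rfl
    · exfalso; have : (0 : ℤ) ≤ D * m ^ 2 := by positivity
      linarith
    · rfl
  have : (m : ℤ) = 1 := by
    by_contra hne
    have h2 : (2 : ℤ) ≤ m := by omega
    nlinarith
  rw [h, this, hd']; ring

theorem sign_of (d : ℤ) (hd : d = 4 ∨ d = -4) : ∃ e : ℤ, (e = 1 ∨ e = -1) ∧ d = 4 * e := by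
  rcases hd with rfl | rfl
  · exact ⟨1, by norm_num, by norm_num⟩
  · exact ⟨-1, by norm_num, by norm_num⟩

/-- No geometric progression contains four distinct integers of the form
`D m² ± 4` with `m` a positive integer (`D` a fixed positive integer). -/
theorem no_four_in_geometric_progression (D : ℕ) (hD : 0 < D) :
    ¬ ∃ (n₁ n₂ n₃ n₄ : ℤ) (r : ℚ), n₁ ≠ 0 ∧ r ≠ 0 ∧
      (n₂ : ℚ) = (n₁ : ℚ) * r ∧ (n₃ : ℚ) = (n₁ : ℚ) * r ^ 2 ∧
      (n₄ : ℚ) = (n₁ : ℚ) * r ^ 3 ∧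
      n₁ ≠ n₂ ∧ n₁ ≠ n₃ ∧ n₁ ≠ n₄ ∧ n₂ ≠ n₃ ∧ n₂ ≠ n₄ ∧ n₃ ≠ n₄ ∧
      (∀ n ∈ ({n₁, n₂, n₃, n₄} : Set ℤ),
        ∃ (m : ℕ) (δ : ℤ), 0 < m ∧ (δ = 4 ∨ δ = -4) ∧
          n = (D : ℤ) * (m : ℤ) ^ 2 + δ) := by
  rintro ⟨n1, n2, n3, n4, r, hn1, hr, g2, g3, g4, d12, d13, -, -, d24, -, H⟩
  obtain ⟨m1, δ1, hm1, hδ1, E1⟩ := H n1 (by simp)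
  obtain ⟨m2, δ2, hm2, hδ2, E2⟩ := H n2 (by simp)
  obtain ⟨m3, δ3, hm3, hδ3, E3⟩ := H n3 (by simp)
  obtain ⟨m4, δ4, hm4, hδ4, E4⟩ := H n4 (by simp)
  clear H
  have hn1q : (n1 : ℚ) ≠ 0 := by exact_mod_cast hn1
  have hr2 : 0 < r ^ 2 := by positivity
  have P1 : 0 < n1 := by
    rcases lt_or_gt_of_ne hn1 with h | h
    · exfalso
      have h3 : n3 < 0 := by
        have h' : (n1 : ℚ) < 0 := by exact_mod_cast h
        have : (n3 : ℚ) < 0 := by rw [g3]; exact mul_neg_of_neg_of_pos h' hr2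
        exact_mod_cast this
      exact d13 ((neg_val D m1 n1 δ1 hD hm1 hδ1 E1 h).trans
        (neg_val D m3 n3 δ3 hD hm3 hδ3 E3 h3).symm)
    · exact h
  have P1q : (0 : ℚ) < n1 := by exact_mod_cast P1
  have g42 : (n4 : ℚ) = n2 * r ^ 2 := by rw [g4, g2]; ring
  have rpos : 0 < r := by
    rcases lt_or_gt_of_ne hr with h | h
    · exfalso
      have h2q : (n2 : ℚ) < 0 := by rw [g2]; exact mul_neg_of_pos_of_neg P1q h
      have h4q : (n4 : ℚ) < 0 := by rw [g42]; exact mul_neg_of_neg_of_pos h2q hr2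
      have h2 : n2 < 0 := by exact_mod_cast h2q
      have h4 : n4 < 0 := by exact_mod_cast h4q
      exact d24 ((neg_val D m2 n2 δ2 hD hm2 hδ2 E2 h2).trans
        (neg_val D m4 n4 δ4 hD hm4 hδ4 E4 h4).symm)
    · exact h
  obtain ⟨e1, he1, rfl⟩ := sign_of δ1 hδ1
  obtain ⟨e2, he2, rfl⟩ := sign_of δ2 hδ2
  obtain ⟨e3, he3, rfl⟩ := sign_of δ3 hδ3
  obtain ⟨e4, he4, rfl⟩ := sign_of δ4 hδ4
  obtain ⟨b, hb⟩ : ∃ b : ℕ, (b : ℤ) = r.num := ⟨r.num.toNat, Int.toNat_of_nonneg (Rat.num_pos.mpr rpos).le⟩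
  have hbpos : 0 < b := by
    have := Rat.num_pos.mpr rpos
    omega
  obtain ⟨a, haa⟩ : ∃ a : ℕ, a = r.den := ⟨_, rfl⟩
  have hapos : 0 < a := by rw [haa]; exact r.den_pos
  have hcop : Nat.Coprime a b := by
    have h := r.reduced
    have : r.num.natAbs = b := by rw [← hb]; simp
    rw [this] at h
    rw [haa]; exact h.symm
  have haq : (a : ℚ) ≠ 0 := by positivity
  have hrab : r * a = b := by
    have h := Rat.mul_den_eq_num r
    rw [← hb, ← haa] at h
    exact_mod_cast h
  have hrr : r = b / a := by field_simp; exact hrab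
  have f2 : n2 * (a : ℤ) = n1 * b := by
    have : (n2 : ℚ) * a = n1 * b := by rw [g2, ← hrab]; ring
    exact_mod_cast this
  have f3 : n3 * (a : ℤ) ^ 2 = n1 * (b : ℤ) ^ 2 := by
    have : (n3 : ℚ) * a ^ 2 = n1 * b ^ 2 := by rw [g3, ← hrab]; ring
    exact_mod_cast this
  have f4 : n4 * (a : ℤ) ^ 3 = n1 * (b : ℤ) ^ 3 := by
    have : (n4 : ℚ) * a ^ 3 = n1 * b ^ 3 := by rw [g4, ← hrab]; ring
    exact_mod_cast this
  have hcz : IsCoprime (a : ℤ) (b : ℤ) := Nat.isCoprime_iff_coprime.mpr hcop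
  have hdvd : (a : ℤ) ^ 3 ∣ n1 := by
    have h : (a : ℤ) ^ 3 ∣ n1 * (b : ℤ) ^ 3 := ⟨n4, by rw [← f4]; ring⟩
    exact (hcz.pow).dvd_of_dvd_mul_right h
  obtain ⟨k', hk'⟩ := hdvd
  have haz : (0 : ℤ) < a := by exact_mod_cast hapos
  have hk0 : 0 < k' := by
    rw [hk'] at P1
    exact pos_of_mul_pos_right P1 (by positivity)
  obtain ⟨k, rfl⟩ : ∃ k : ℕ, k' = k := ⟨k'.toNat, (Int.toNat_of_nonneg hk0.le).symm⟩
  have hk : 0 < k := by exact_mod_cast hk0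
  have v1 : n1 = (k : ℤ) * a ^ 3 := by rw [hk']; ring
  have v2 : n2 = (k : ℤ) * a ^ 2 * b := by
    apply mul_right_cancel₀ haz.ne'
    rw [f2, v1]; ring
  have v3 : n3 = (k : ℤ) * a * b ^ 2 := by
    apply mul_right_cancel₀ (pow_pos haz 2).ne'
    rw [f3, v1]; ring
  have v4 : n4 = (k : ℤ) * b ^ 3 := by
    apply mul_right_cancel₀ (pow_pos haz 3).ne'
    rw [f4, v1]; ring
  rcases lt_trichotomy a b with h | h | h
  · exact core k a b D m1 m2 m3 m4 e1 e2 e3 e4 hk hapos h hcop hD hm1 hm2 hm3 hm4 he1 he2 he3 he4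
      (v1.symm.trans E1) (v2.symm.trans E2) (v3.symm.trans E3) (v4.symm.trans E4)
  · apply d12
    rw [v1, v2, h]; ring
  · exact core k b a D m4 m3 m2 m1 e4 e3 e2 e1 hk hbpos h hcop.symm hD hm4 hm3 hm2 hm1
      he4 he3 he2 he1 (v4.symm.trans E4)
      (by rw [← E3, v3]; ring) (by rw [← E2, v2]; ring) (v1.symm.trans E1)
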